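/- Suppose (A_t), 0 ≤ t ≤ 1, is a continuous path of positive n×n real matrices such that every A_t is shift equivalent over ℝ to A₀. Then A₀ and A₁ are strong shift equivalent over ℝ₊. -/

import Mathlib

open Matrix

/-- All entries of a real matrix lie in the set `S`. -/
def entriesIn {m n : ℕ} (S : Set ℝ) (A : Matrix (Fin m) (Fin n) ℝ) : Prop :=
  ∀ i j, A i j ∈ S

/-- A matrix is positive if every entry is positive. -/
def PosEntries {m n : ℕ} (A : Matrix (Fin m) (Fin n) ℝ) : Prop :=
  ∀ i j, 0 < A i j

/-- Elementary strong shift equivalence over `S` between square real matrices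
(of possibly different sizes). -/
def ESSE (S : Set ℝ) (p q : (n : ℕ) × Matrix (Fin n) (Fin n) ℝ) : Prop :=
  ∃ (R : Matrix (Fin p.1) (Fin q.1) ℝ) (S' : Matrix (Fin q.1) (Fin p.1) ℝ),
    entriesIn S R ∧ entriesIn S S' ∧ p.2 = R * S' ∧ q.2 = S' * R

/-- Strong shift equivalence over `S`: a finite chain of elementary strong shift
equivalences. -/
def SSE (S : Set ℝ) : ((n : ℕ) × Matrix (Fin n) (Fin n) ℝ) →
    ((n : ℕ) × Matrix (Fin n) (Fin n) ℝ) → Prop :=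
  Relation.ReflTransGen (ESSE S)

open Topology Filter

section Basics

variable {ι κ μ : Type} [Fintype ι] [Fintype κ] [Fintype μ]

/-- Strong shift equivalence over the nonnegative reals for matrices with arbitrary finite index
types. -/
def NonnegSSE (A : Matrix ι ι ℝ) (B : Matrix κ κ ℝ) : Prop :=
  SSE {x : ℝ | 0 ≤ x}
    ⟨_, A.submatrix (Fintype.equivFin ι).symm (Fintype.equivFin ι).symm⟩
    ⟨_, B.submatrix (Fintype.equivFin κ).symm (Fintype.equivFin κ).symm⟩

theorem SSE.symm {S : Set ℝ} {p q : (n : ℕ) × Matrix (Fin n) (Fin n) ℝ} (h : SSE S p q) :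
    SSE S q p := by
  induction h with
  | refl => exact Relation.ReflTransGen.refl
  | tail _ hs ih =>
    obtain ⟨R, S', hR, hS', h₁, h₂⟩ := hs
    exact Relation.ReflTransGen.head ⟨S', R, hS', hR, h₂, h₁⟩ ih

theorem NonnegSSE.symm {A : Matrix ι ι ℝ} {B : Matrix κ κ ℝ} (h : NonnegSSE A B) :
    NonnegSSE B A :=
  SSE.symm h

theorem NonnegSSE.trans {A : Matrix ι ι ℝ} {B : Matrix κ κ ℝ} {C : Matrix μ μ ℝ}
    (h₁ : NonnegSSE A B) (h₂ : NonnegSSE B C) : NonnegSSE A C :=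
  Relation.ReflTransGen.trans h₁ h₂

theorem NonnegSSE.refl (A : Matrix ι ι ℝ) : NonnegSSE A A :=
  Relation.ReflTransGen.refl

theorem NonnegSSE.of_mul {R : Matrix ι κ ℝ} {S : Matrix κ ι ℝ} (hR : ∀ i j, 0 ≤ R i j)
    (hS : ∀ i j, 0 ≤ S i j) : NonnegSSE (R * S) (S * R) := by
  refine Relation.ReflTransGen.single
    ⟨R.submatrix (Fintype.equivFin ι).symm (Fintype.equivFin κ).symm,
      S.submatrix (Fintype.equivFin κ).symm (Fintype.equivFin ι).symm,
      fun i j => hR _ _, fun i j => hS _ _, ?_, ?_⟩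
  · exact (Matrix.submatrix_mul_equiv R S _ _ _).symm
  · exact (Matrix.submatrix_mul_equiv S R _ _ _).symm

theorem NonnegSSE.toSSE {n : ℕ} {A B : Matrix (Fin n) (Fin n) ℝ} (hA : ∀ i j, 0 ≤ A i j)
    (hB : ∀ i j, 0 ≤ B i j) (h : NonnegSSE A B) :
    SSE {x : ℝ | 0 ≤ x} ⟨n, A⟩ ⟨n, B⟩ := by
  have key : ∀ C : Matrix (Fin n) (Fin n) ℝ, (∀ i j, 0 ≤ C i j) →
      SSE {x : ℝ | 0 ≤ x} ⟨n, C⟩ ⟨_, C.submatrix (Fintype.equivFin (Fin n)).symm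
        (Fintype.equivFin (Fin n)).symm⟩ := by
    intro C hC
    refine Relation.ReflTransGen.single
      ⟨C.submatrix id (Fintype.equivFin (Fin n)).symm,
        (1 : Matrix (Fin n) (Fin n) ℝ).submatrix (Fintype.equivFin (Fin n)).symm id,
        fun i j => hC _ _, fun i j => ?_, ?_, ?_⟩
    · simp only [Matrix.submatrix_apply, Matrix.one_apply, Set.mem_ofPred_eq]
      split_ifs <;> norm_num
    · dsimp only
      rw [Matrix.submatrix_mul_equiv, Matrix.mul_one, Matrix.submatrix_id_id]
    · dsimp only
      rw [← Matrix.submatrix_mul _ _ _ _ _ Function.bijective_id, Matrix.one_mul]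
  exact ((key A hA).trans h).trans (key B hB).symm

end Basics

section Conjugation

theorem isOpen_forall_entries_pos {ι κ : Type} [Finite ι] [Finite κ] :
    IsOpen {M : Matrix ι κ ℝ | ∀ i j, 0 < M i j} := by
  simp only [Set.ofPred_forall]
  refine isOpen_iInter_of_finite fun i => isOpen_iInter_of_finite fun j => ?_
  exact isOpen_lt continuous_const (by fun_prop)

variable {ι : Type} [Fintype ι] [DecidableEq ι]

theorem tendsto_matrix_inv {α : Type*} {l : Filter α} {f : α → Matrix ι ι ℝ} {M : Matrix ι ι ℝ}
    (hM : M.det ≠ 0) (hf : Tendsto f l (𝓝 M)) : Tendsto (fun a => (f a)⁻¹) l (𝓝 M⁻¹) := by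
  have h : ContinuousAt Inv.inv M := by
    apply continuousAt_matrix_inv
    rw [Ring.inverse_eq_inv']
    exact continuousAt_inv₀ hM
  exact h.tendsto.comp hf

/-- Conjugating a matrix close to a positive one by a matrix close to the identity does not change
its strong shift equivalence class. -/
theorem eventually_nonnegSSE_of_intertwine {T₀ : Matrix ι ι ℝ} (hT₀ : ∀ i j, 0 < T₀ i j) :
    ∀ᶠ p : Matrix ι ι ℝ × Matrix ι ι ℝ × Matrix ι ι ℝ in 𝓝 (T₀, T₀, 1),
      p.1 * p.2.2 = p.2.2 * p.2.1 → NonnegSSE p.1 p.2.1 := by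
  set H : ℝ → Matrix ι ι ℝ := fun x => 1 + x • Matrix.of (fun _ _ => (1 : ℝ)) with hH
  have hHc : Tendsto H (𝓝 0) (𝓝 1) := by
    have : Continuous H := by fun_prop
    simpa [hH] using this.tendsto 0
  obtain ⟨x, hx, hdet, hpos⟩ : ∃ x > 0, (H x).det ≠ 0 ∧ ∀ i j, 0 < ((H x)⁻¹ * T₀) i j := by
    have h1 : ∀ᶠ x in 𝓝 (0 : ℝ), (H x).det ≠ 0 := by
      have : Tendsto (fun x => (H x).det) (𝓝 0) (𝓝 (1 : Matrix ι ι ℝ).det) :=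
        (Continuous.matrix_det continuous_id).continuousAt.tendsto.comp hHc
      exact this.eventually_ne (by simp)
    have h2 : ∀ᶠ x in 𝓝 (0 : ℝ), ∀ i j, 0 < ((H x)⁻¹ * T₀) i j := by
      have : Tendsto (fun x => (H x)⁻¹ * T₀) (𝓝 0) (𝓝 ((1 : Matrix ι ι ℝ)⁻¹ * T₀)) :=
        (tendsto_matrix_inv (by simp) hHc).mul tendsto_const_nhds
      exact this.eventually (isOpen_forall_entries_pos.mem_nhds (by simpa using hT₀))
    have h3 : ∀ᶠ x in 𝓝[>] (0 : ℝ), 0 < x := eventually_mem_nhdsWithin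
    obtain ⟨x, h⟩ := (h3.and ((h1.and h2).filter_mono nhdsWithin_le_nhds)).exists
    exact ⟨x, h.1, h.2⟩
  have hHpos : ∀ i j, 0 < H x i j := by
    intro i j
    simp only [hH, Matrix.add_apply, Matrix.one_apply, Matrix.smul_apply, Matrix.of_apply]
    split_ifs <;> simp <;> positivity
  have t1 : Tendsto (fun p : Matrix ι ι ℝ × Matrix ι ι ℝ × Matrix ι ι ℝ => p.1)
      (𝓝 (T₀, T₀, 1)) (𝓝 T₀) := continuous_fst.tendsto _
  have t2 : Tendsto (fun p : Matrix ι ι ℝ × Matrix ι ι ℝ × Matrix ι ι ℝ => p.2.1)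
      (𝓝 (T₀, T₀, 1)) (𝓝 T₀) := (continuous_fst.comp continuous_snd).tendsto _
  have t3 : Tendsto (fun p : Matrix ι ι ℝ × Matrix ι ι ℝ × Matrix ι ι ℝ => p.2.2 * H x)
      (𝓝 (T₀, T₀, 1)) (𝓝 (H x)) := by
    have := ((continuous_snd.comp continuous_snd).tendsto (T₀, T₀, (1 : Matrix ι ι ℝ))).mul
      (tendsto_const_nhds (x := H x))
    simpa using this
  have e1 := t3.eventually (isOpen_forall_entries_pos.mem_nhds hHpos)
  have e2 := ((tendsto_matrix_inv hdet t3).mul t1).eventually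
    (isOpen_forall_entries_pos.mem_nhds hpos)
  have e3 := ((tendsto_const_nhds (x := (H x)⁻¹)).mul t2).eventually
    (isOpen_forall_entries_pos.mem_nhds hpos)
  have e4 : ∀ᶠ p : Matrix ι ι ℝ × Matrix ι ι ℝ × Matrix ι ι ℝ in 𝓝 (T₀, T₀, 1),
      (p.2.2 * H x).det ≠ 0 :=
    (((Continuous.matrix_det continuous_id).continuousAt.tendsto).comp t3).eventually_ne hdet
  filter_upwards [e1, e2, e3, e4] with ⟨T, T', G⟩ h1 h2 h3 h4 h
  dsimp only at *
  have u : IsUnit (G * H x).det := isUnit_iff_ne_zero.mpr h4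
  have uH : IsUnit (H x).det := isUnit_iff_ne_zero.mpr hdet
  have uG : IsUnit G.det := by
    rw [Matrix.det_mul] at u
    exact isUnit_of_mul_isUnit_left u
  have s1 := NonnegSSE.of_mul (fun i j => (h1 i j).le) (fun i j => (h2 i j).le)
  have s2 := NonnegSSE.of_mul (fun i j => (hHpos i j).le) (fun i j => (h3 i j).le)
  rw [Matrix.mul_nonsing_inv_cancel_left _ _ u] at s1
  rw [Matrix.mul_nonsing_inv_cancel_left _ _ uH] at s2
  have e : (G * H x)⁻¹ * T * (G * H x) = (H x)⁻¹ * T' * H x := by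
    rw [Matrix.mul_inv_rev, mul_assoc, ← mul_assoc T, h, mul_assoc, mul_assoc G,
      Matrix.nonsing_inv_mul_cancel_left _ _ uG, mul_assoc]
  rw [e] at s1
  exact s1.trans s2.symm

end Conjugation

section ConstantRank

/-- If the rank of a family of operators does not jump up at a point, then every vector of the
kernel at this point is close to vectors of the nearby kernels. -/
theorem eventually_exists_mem_ker {V P : Type*} [NormedAddCommGroup V] [NormedSpace ℝ V]
    [FiniteDimensional ℝ V] [TopologicalSpace P] {Ψ : P → V →L[ℝ] V} {p₀ : P}
    (hΨ : ContinuousAt Ψ p₀) {x₀ : V} (hx₀ : Ψ p₀ x₀ = 0) {W : Set V} (hW : W ∈ 𝓝 x₀) :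
    ∀ᶠ p in 𝓝 p₀, Module.finrank ℝ (LinearMap.range (Ψ p).toLinearMap) ≤
      Module.finrank ℝ (LinearMap.range (Ψ p₀).toLinearMap) → ∃ x ∈ W, Ψ p x = 0 := by
  have := FiniteDimensional.complete ℝ V
  obtain ⟨g, hg⟩ := (Ψ p₀).toLinearMap.rangeRestrict.exists_rightInverse_of_surjective
    (LinearMap.range_rangeRestrict _)
  obtain ⟨q, hq⟩ := LinearMap.exists_extend g
  set Q : V →L[ℝ] V := LinearMap.toContinuousLinearMap q with hQ
  have hinv : ∀ x, Ψ p₀ (Q (Ψ p₀ x)) = Ψ p₀ x := by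
    intro x
    have h1 : q (Ψ p₀ x) = g ((Ψ p₀).toLinearMap.rangeRestrict x) :=
      LinearMap.congr_fun hq ((Ψ p₀).toLinearMap.rangeRestrict x)
    have h2 := congrArg Subtype.val
      (LinearMap.congr_fun hg ((Ψ p₀).toLinearMap.rangeRestrict x))
    simp only [hQ, LinearMap.coe_toContinuousLinearMap', h1]
    exact h2
  set J : P → V →L[ℝ] V := fun p => 1 + Q * (Ψ p - Ψ p₀) with hJ
  have hJt : Tendsto J (𝓝 p₀) (𝓝 1) := by
    have : Tendsto J (𝓝 p₀) (𝓝 (1 + Q * (Ψ p₀ - Ψ p₀))) :=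
      tendsto_const_nhds.add (tendsto_const_nhds.mul (hΨ.tendsto.sub tendsto_const_nhds))
    simpa using this
  have hunit : ∀ᶠ p in 𝓝 p₀, IsUnit (J p) :=
    hJt.eventually (Units.isOpen.mem_nhds isUnit_one)
  have hJinv : Tendsto (fun p => Ring.inverse (J p) x₀) (𝓝 p₀) (𝓝 x₀) := by
    have h1 := (NormedRing.inverse_continuousAt (1 : (V →L[ℝ] V)ˣ)).tendsto
    rw [Units.val_one, Ring.inverse_one] at h1
    exact ((ContinuousLinearMap.apply ℝ V x₀).continuous.tendsto _).comp (h1.comp hJt)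
  filter_upwards [hunit, hJinv.eventually hW] with p hu hpW hrank
  have hJker : (LinearMap.ker (Ψ p).toLinearMap).map (J p).toLinearMap ≤
      LinearMap.ker (Ψ p₀).toLinearMap := by
    rintro _ ⟨x, hx, rfl⟩
    have hx' : Ψ p x = 0 := hx
    simp [hJ, hx', hinv]
  have hleft : ∀ x, Ring.inverse (J p) (J p x) = x := fun x => by
    change (Ring.inverse (J p) * J p) x = x
    rw [Ring.inverse_mul_cancel _ hu, one_apply_eq_self]
  have hJinj : Function.Injective (J p) := Function.LeftInverse.injective hleft
  have heq : (LinearMap.ker (Ψ p).toLinearMap).map (J p).toLinearMap =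
      LinearMap.ker (Ψ p₀).toLinearMap := by
    refine Submodule.eq_of_le_of_finrank_le hJker ?_
    have h1 := (Ψ p).toLinearMap.finrank_range_add_finrank_ker
    have h2 := (Ψ p₀).toLinearMap.finrank_range_add_finrank_ker
    have h3 : Module.finrank ℝ ((LinearMap.ker (Ψ p).toLinearMap).map (J p).toLinearMap) =
        Module.finrank ℝ (LinearMap.ker (Ψ p).toLinearMap) :=
      (Submodule.equivMapOfInjective (J p).toLinearMap hJinj _).finrank_eq.symm
    omega
  have hx₀' : x₀ ∈ (LinearMap.ker (Ψ p).toLinearMap).map (J p).toLinearMap := heq ▸ hx₀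
  obtain ⟨x, hx, hxx⟩ := hx₀'
  have hxe : x = Ring.inverse (J p) x₀ := by
    rw [← hxx]
    exact (hleft x).symm
  exact ⟨x, hxe ▸ hpW, hx⟩

end ConstantRank

section NearIntertwiner

variable {ι : Type} [Fintype ι] [DecidableEq ι]

/-- Shift equivalence over `ℝ` of two matrices of the same size. -/
def RealSE (A B : Matrix ι ι ℝ) : Prop :=
  ∃ (ℓ : ℕ) (R S : Matrix ι ι ℝ),
    1 ≤ ℓ ∧ A ^ ℓ = R * S ∧ B ^ ℓ = S * R ∧ A * R = R * B ∧ S * A = B * S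

theorem RealSE.symm {A B : Matrix ι ι ℝ} (h : RealSE A B) : RealSE B A := by
  obtain ⟨ℓ, R, S, h0, h1, h2, h3, h4⟩ := h
  exact ⟨ℓ, S, R, h0, h2, h1, h4.symm, h3.symm⟩

theorem SemiconjBy.mul_pow_eq {M : Type*} [Monoid M] {a x y : M} (h : a * x = y * a) (m : ℕ) :
    a * x ^ m = y ^ m * a :=
  (show SemiconjBy a x y from h).pow_right m

theorem RealSE.trans {A B C : Matrix ι ι ℝ} (h : RealSE A B) (h' : RealSE B C) :
    RealSE A C := by
  obtain ⟨ℓ, R, S, h0, h1, h2, h3, h4⟩ := h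
  obtain ⟨ℓ', R', S', h0', h1', h2', h3', h4'⟩ := h'
  refine ⟨ℓ + ℓ', R * R', S' * S, by omega, ?_, ?_, ?_, ?_⟩
  · have := SemiconjBy.mul_pow_eq h3.symm ℓ'
    rw [add_comm, pow_add, h1, ← mul_assoc, ← this, h1']
    simp only [mul_assoc]
  · have := SemiconjBy.mul_pow_eq h4' ℓ
    rw [pow_add, h2', ← mul_assoc, ← this, h2]
    simp only [mul_assoc]
  · rw [← mul_assoc, h3, mul_assoc, h3', mul_assoc]
  · rw [mul_assoc, h4, ← mul_assoc, h4', mul_assoc]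

theorem RealSE.exists_charpoly_pow_eq {A B : Matrix ι ι ℝ} (h : RealSE A B) :
    ∃ ℓ : ℕ, (A ^ ℓ).charpoly = (B ^ ℓ).charpoly ∧ 1 ≤ ℓ := by
  obtain ⟨ℓ, R, S, h0, h1, h2, -, -⟩ := h
  exact ⟨ℓ, by rw [h1, h2, Matrix.charpoly_mul_comm], h0⟩

/-- Right multiplication by `B` stabilizes from the dimension of the matrix space on. -/
theorem Matrix.mul_pow_finrank_eq_zero {B Q : Matrix ι ι ℝ} {m : ℕ} (h : Q * B ^ m = 0) :
    Q * B ^ Module.finrank ℝ (Matrix ι ι ℝ) = 0 := by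
  set d := Module.finrank ℝ (Matrix ι ι ℝ)
  have hk := Module.End.ker_pow_eq_ker_pow_finrank_of_le (f := LinearMap.mulRight ℝ B)
    (m := d + m) (Nat.le_add_right _ _)
  have : Q ∈ LinearMap.ker (LinearMap.mulRight ℝ B ^ (d + m)) := by
    rw [LinearMap.mem_ker, LinearMap.pow_mulRight, LinearMap.mulRight_apply, add_comm, pow_add,
      ← mul_assoc, h, zero_mul]
  rw [hk, LinearMap.mem_ker, LinearMap.pow_mulRight, LinearMap.mulRight_apply] at this
  exact this

/-- The matrices `X` annihilated by this map intertwine `A` and `B` on the image of `B ^ d`. -/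
def intertwineMap (d : ℕ) (A B : Matrix ι ι ℝ) : Matrix ι ι ℝ →ₗ[ℝ] Matrix ι ι ℝ :=
  LinearMap.mulRight ℝ (B ^ d) ∘ₗ (LinearMap.mulLeft ℝ A - LinearMap.mulRight ℝ B)

theorem RealSE.finrank_range_intertwineMap_le {A B : Matrix ι ι ℝ} (h : RealSE A B) :
    Module.finrank ℝ (LinearMap.range
      (intertwineMap (Module.finrank ℝ (Matrix ι ι ℝ)) A B)) ≤
    Module.finrank ℝ (LinearMap.range
      (intertwineMap (Module.finrank ℝ (Matrix ι ι ℝ)) A A)) := by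
  obtain ⟨ℓ, R, S, h0, h1, h2, h3, h4⟩ := h
  set d := Module.finrank ℝ (Matrix ι ι ℝ)
  set f := (LinearMap.mulRight ℝ S).domRestrict (LinearMap.range (intertwineMap d A B)) with hf
  have hinj : Function.Injective f := by
    rw [← LinearMap.ker_eq_bot, LinearMap.ker_eq_bot']
    rintro ⟨_, X, rfl⟩ hX
    have hX' : (A * X - X * B) * B ^ d * S = 0 := hX
    have : (A * X - X * B) * B ^ (d + ℓ) = 0 := by
      rw [pow_add, h2, ← mul_assoc, ← mul_assoc, hX', zero_mul]
    exact Subtype.ext (Matrix.mul_pow_finrank_eq_zero this)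
  rw [← LinearMap.finrank_range_of_inj hinj]
  refine Submodule.finrank_mono ?_
  rintro _ ⟨⟨_, X, rfl⟩, rfl⟩
  refine ⟨X * S, ?_⟩
  change (A * (X * S) - X * S * A) * A ^ d = (A * X - X * B) * B ^ d * S
  rw [mul_assoc _ (B ^ d), ← SemiconjBy.mul_pow_eq h4, mul_assoc X, h4, ← mul_assoc, ← mul_assoc,
    ← sub_mul, mul_assoc _ S]

attribute [local instance] Matrix.linftyOpNormedRing Matrix.linftyOpNormedAlgebra in
/-- A matrix close to `A` and shift equivalent to `A` is intertwined with `A`, on its eventual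
image, by a matrix close to the identity. -/
theorem eventually_exists_intertwiner (A : Matrix ι ι ℝ) {W : Set (Matrix ι ι ℝ)}
    (hW : W ∈ 𝓝 1) : ∀ᶠ B in 𝓝 A, RealSE A B →
      ∃ L ∈ W, (A * L - L * B) * B ^ Module.finrank ℝ (Matrix ι ι ℝ) = 0 := by
  set d := Module.finrank ℝ (Matrix ι ι ℝ)
  set Ψ : Matrix ι ι ℝ → Matrix ι ι ℝ →L[ℝ] Matrix ι ι ℝ := fun B =>
    (ContinuousLinearMap.mul ℝ (Matrix ι ι ℝ)).flip (B ^ d) ∘L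
      (ContinuousLinearMap.mul ℝ (Matrix ι ι ℝ) A -
        (ContinuousLinearMap.mul ℝ (Matrix ι ι ℝ)).flip B) with hΨ
  have hlin : ∀ B, (Ψ B).toLinearMap = intertwineMap d A B := fun B => rfl
  have hcont : Continuous Ψ := by
    simp only [hΨ]
    fun_prop
  have key := eventually_exists_mem_ker (hcont.continuousAt (x := A)) (x₀ := 1)
    (by change (A * 1 - 1 * A) * A ^ d = 0; simp) hW
  filter_upwards [key] with B hB hse
  obtain ⟨L, hL, h0⟩ := hB (by rw [hlin, hlin]; exact hse.finrank_range_intertwineMap_le)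
  exact ⟨L, hL, h0⟩

end NearIntertwiner

section ExtensionModel

variable {ι : Type} [Fintype ι] [DecidableEq ι] {k : ℕ}

/-- The change of basis which makes zero extensions of positive matrices positive. -/
def extBasis (ι : Type) [DecidableEq ι] [Fintype ι] (k : ℕ) (η : ℝ) :
    Matrix (ι ⊕ Fin k) (ι ⊕ Fin k) ℝ :=
  fromBlocks 1 (of fun _ _ => 1) 0 1 * fromBlocks 1 0 (of fun _ _ => -η) 1

/-- The inverse of `extBasis`. -/
def extBasisInv (ι : Type) [DecidableEq ι] [Fintype ι] (k : ℕ) (η : ℝ) :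
    Matrix (ι ⊕ Fin k) (ι ⊕ Fin k) ℝ :=
  fromBlocks 1 0 (of fun _ _ => η) 1 * fromBlocks 1 (of fun _ _ => -1) 0 1

/-- The matrix `T` written in the basis `extBasis`. -/
def extModel (η : ℝ) (T : Matrix (ι ⊕ Fin k) (ι ⊕ Fin k) ℝ) :
    Matrix (ι ⊕ Fin k) (ι ⊕ Fin k) ℝ :=
  extBasisInv ι k η * T * extBasis ι k η

theorem extBasisInv_mul_extBasis (η : ℝ) : extBasisInv ι k η * extBasis ι k η = 1 := by
  have h1 : (fromBlocks 1 (of fun _ _ => -1) 0 1 : Matrix (ι ⊕ Fin k) (ι ⊕ Fin k) ℝ) *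
      fromBlocks 1 (of fun _ _ => 1) 0 1 = 1 := by
    rw [fromBlocks_multiply, ← fromBlocks_one]
    congr 1 <;> ext i j <;> simp
  have h2 : (fromBlocks 1 0 (of fun _ _ => η) 1 : Matrix (ι ⊕ Fin k) (ι ⊕ Fin k) ℝ) *
      fromBlocks 1 0 (of fun _ _ => -η) 1 = 1 := by
    rw [fromBlocks_multiply, ← fromBlocks_one]
    congr 1 <;> ext i j <;> simp
  rw [extBasisInv, extBasis, mul_assoc, ← mul_assoc (fromBlocks 1 (of fun _ _ => -1) 0 1), h1,
    one_mul, h2]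

theorem extBasis_mul_extBasisInv (η : ℝ) : extBasis ι k η * extBasisInv ι k η = 1 :=
  mul_eq_one_comm.mp (extBasisInv_mul_extBasis η)

theorem extModel_mul (η : ℝ) (T T' : Matrix (ι ⊕ Fin k) (ι ⊕ Fin k) ℝ) :
    extModel η (T * T') = extModel η T * extModel η T' := by
  simp only [extModel, mul_assoc]
  rw [← mul_assoc (extBasis ι k η), extBasis_mul_extBasisInv, one_mul]

theorem continuous_extModel (η : ℝ) :
    Continuous (extModel η : Matrix (ι ⊕ Fin k) (ι ⊕ Fin k) ℝ → _) := by
  unfold extModel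
  fun_prop

theorem extModel_fromBlocks (η : ℝ) (A : Matrix ι ι ℝ) (Y W : Matrix ι (Fin k) ℝ)
    (Z : Matrix (Fin k) (Fin k) ℝ) (hW : ∀ a j, W a j = ∑ b, A a b + Y a j - ∑ l, Z l j) :
    extModel η (fromBlocks A Y 0 Z) = fromBlocks
      (of fun a b => A a b - η * ∑ j, W a j) W
      (of fun j b => η * ∑ a, (A a b - η * ∑ l, W a l) - η * ∑ l, Z j l)
      (of fun j l => η * ∑ a, W a l + Z j l) := by
  have h1 : (fromBlocks 1 (of fun _ _ => -1) 0 1 : Matrix (ι ⊕ Fin k) (ι ⊕ Fin k) ℝ) *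
      (fromBlocks A Y 0 Z * fromBlocks 1 (of fun _ _ => 1) 0 1) = fromBlocks A W 0 Z := by
    rw [fromBlocks_multiply, fromBlocks_multiply]
    congr 1 <;> ext i j <;>
      simp [Matrix.mul_apply, hW, sub_eq_add_neg]
  have h2 : extModel η (fromBlocks A Y 0 Z) = fromBlocks 1 0 (of fun _ _ => η) 1 *
      (fromBlocks A W 0 Z * fromBlocks 1 0 (of fun _ _ => -η) 1) := by
    rw [← h1, extModel, extBasisInv, extBasis]
    simp only [mul_assoc]
  rw [h2, fromBlocks_multiply, fromBlocks_multiply]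
  congr 1 <;> ext i j <;>
    simp [Matrix.mul_apply, Finset.mul_sum, mul_comm, sub_eq_add_neg]

theorem eventually_extModel_pos [Nonempty ι] {A : Matrix ι ι ℝ} (hA : ∀ i j, 0 < A i j) (k : ℕ) :
    ∀ᶠ η in 𝓝[>] (0 : ℝ), ∀ i j,
      0 < extModel η (fromBlocks A (0 : Matrix ι (Fin k) ℝ) 0 0) i j := by
  have hsmall : ∀ᶠ η in 𝓝 (0 : ℝ), ∀ a b, 0 < A a b - η * ∑ _j : Fin k, ∑ c, A a c := by
    refine eventually_all.mpr fun a => eventually_all.mpr fun b => ?_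
    have : Tendsto (fun η : ℝ => A a b - η * ∑ _j : Fin k, ∑ c, A a c) (𝓝 0) (𝓝 (A a b)) := by
      have hc : Continuous (fun η : ℝ => A a b - η * ∑ _j : Fin k, ∑ c, A a c) := by fun_prop
      simpa using hc.tendsto 0
    exact this.eventually (lt_mem_nhds (hA a b))
  filter_upwards [eventually_mem_nhdsWithin, hsmall.filter_mono nhdsWithin_le_nhds] with η hη h
  have hη' : 0 < η := hη
  have hW : ∀ a, 0 < ∑ c, A a c := fun a =>
    Finset.sum_pos (fun c _ => hA a c) Finset.univ_nonempty
  rw [extModel_fromBlocks η A 0 (of fun a _ => ∑ c, A a c) 0 (by simp)]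
  rintro (a | j) (b | l)
  · exact h a b
  · exact hW a
  · have := mul_pos hη' (Finset.sum_pos (fun a _ => h a b) Finset.univ_nonempty)
    simpa using this
  · have := mul_pos hη' (Finset.sum_pos (fun a _ => hW a) Finset.univ_nonempty)
    simpa using this

theorem exists_mem_nhds_of_eventually_prod {X Y : Type*} [TopologicalSpace X] [TopologicalSpace Y]
    {x : X} {y : Y} {Q : X → X → Y → Prop}
    (h : ∀ᶠ p : X × X × Y in 𝓝 (x, x, y), Q p.1 p.2.1 p.2.2) :
    ∃ U ∈ 𝓝 x, ∃ W ∈ 𝓝 y, ∀ a ∈ U, ∀ b ∈ U, ∀ c ∈ W, Q a b c := by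
  rw [nhds_prod_eq, nhds_prod_eq, eventually_prod_iff] at h
  obtain ⟨p, hp, q, hq, hpq⟩ := h
  obtain ⟨p', hp', q', hq', hpq'⟩ := eventually_prod_iff.mp hq
  exact ⟨{T | p T ∧ p' T}, hp.and hp', {G | q' G}, hq', fun T hT T' hT' G hG =>
    hpq hT.1 (hpq' hT'.2 hG)⟩

theorem exists_nhds_nonnegSSE_extModel_of_intertwine {η : ℝ}
    {T₀ : Matrix (ι ⊕ Fin k) (ι ⊕ Fin k) ℝ} (hT₀ : ∀ i j, 0 < extModel η T₀ i j) :
    ∃ U ∈ 𝓝 T₀, ∃ W ∈ 𝓝 (1 : Matrix (ι ⊕ Fin k) (ι ⊕ Fin k) ℝ), ∀ T ∈ U, ∀ T' ∈ U, ∀ G ∈ W,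
      T * G = G * T' → NonnegSSE (extModel η T) (extModel η T') := by
  have hone : extModel η (1 : Matrix (ι ⊕ Fin k) (ι ⊕ Fin k) ℝ) = 1 := by
    rw [extModel, mul_one, extBasisInv_mul_extBasis]
  obtain ⟨U, hU, W, hW, h⟩ := exists_mem_nhds_of_eventually_prod
    (Q := fun T T' G => T * G = G * T' → NonnegSSE T T')
    (eventually_nonnegSSE_of_intertwine hT₀)
  have hc := continuous_extModel (ι := ι) (k := k) η
  refine ⟨extModel η ⁻¹' U, hc.continuousAt hU, extModel η ⁻¹' W,
    hc.continuousAt (by rwa [hone]), fun T hT T' hT' G hG hTG => h _ hT _ hT' _ hG ?_⟩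
  rw [← extModel_mul, hTG, extModel_mul]

/-- Amalgamation of an index whose row is proportional to a sum of other rows. -/
theorem nonnegSSE_amalgamate {η : ℝ} (hη : 0 ≤ η) (i : Fin (k + 1))
    {V : Matrix (ι ⊕ Fin (k + 1)) (ι ⊕ Fin (k + 1)) ℝ} (hV : ∀ c c', 0 ≤ V c c')
    (hrow : ∀ c, V (Sum.inr i) c = η * ∑ a, V (Sum.inl a) c)
    {V' : Matrix (ι ⊕ Fin k) (ι ⊕ Fin k) ℝ}
    (hl : ∀ c b, V' c (Sum.inl b) = V (Sum.map id i.succAbove c) (Sum.inl b) +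
      V (Sum.map id i.succAbove c) (Sum.inr i) * η)
    (hr : ∀ c j, V' c (Sum.inr j) = V (Sum.map id i.succAbove c) (Sum.inr (i.succAbove j))) :
    NonnegSSE V V' := by
  set R : Matrix (ι ⊕ Fin k) (ι ⊕ Fin (k + 1)) ℝ := V.submatrix (Sum.map id i.succAbove) id
  set S : Matrix (ι ⊕ Fin (k + 1)) (ι ⊕ Fin k) ℝ := fromBlocks 1 0
    (of fun j _ => if j = i then η else 0) (of fun j l => if j = i.succAbove l then 1 else 0)
  have hS : ∀ c c', 0 ≤ S c c' := by
    rintro (a | j) (b | l) <;> simp only [S, fromBlocks_apply₁₁, fromBlocks_apply₁₂,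
      fromBlocks_apply₂₁, fromBlocks_apply₂₂, Matrix.one_apply, of_apply, Matrix.zero_apply] <;>
      try split_ifs
    all_goals first | exact hη | norm_num
  have h1 : S * R = V := by
    ext c c'
    rcases c with a | j
    · simp [S, R, Matrix.mul_apply, Fintype.sum_sum_type, Matrix.one_apply]
    · rcases Fin.eq_self_or_eq_succAbove i j with rfl | ⟨l, rfl⟩
      · simp [S, R, Matrix.mul_apply, Fintype.sum_sum_type, hrow, Finset.mul_sum,
          (Fin.succAbove_ne _ _).symm]
      · simp [S, R, Matrix.mul_apply, Fintype.sum_sum_type, Fin.succAbove_ne]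
  have h2 : R * S = V' := by
    ext c c'
    rcases c' with b | l
    · simp [S, R, Matrix.mul_apply, Fintype.sum_sum_type, Matrix.one_apply, hl]
    · simp [S, R, Matrix.mul_apply, Fintype.sum_sum_type, hr]
  have hR : ∀ c c', 0 ≤ R c c' := fun c c' => hV _ _
  have := NonnegSSE.of_mul hS hR
  rwa [h1, h2] at this

/-- A zero row of the lower right block can be removed. -/
theorem nonnegSSE_extModel_succAbove {η : ℝ} (hη : 0 ≤ η) (i : Fin (k + 1)) {A : Matrix ι ι ℝ}
    {Y : Matrix ι (Fin (k + 1)) ℝ} {Z : Matrix (Fin (k + 1)) (Fin (k + 1)) ℝ}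
    (hZ : ∀ l, Z i l = 0) (hV : ∀ c c', 0 ≤ extModel η (fromBlocks A Y 0 Z) c c') :
    NonnegSSE (extModel η (fromBlocks A Y 0 Z)) (extModel η
      (fromBlocks A (Y.submatrix id i.succAbove) 0 (Z.submatrix i.succAbove i.succAbove))) := by
  set W : Matrix ι (Fin (k + 1)) ℝ := of fun a j => ∑ b, A a b + Y a j - ∑ l, Z l j with hW
  have e1 := extModel_fromBlocks η A Y W Z (fun _ _ => rfl)
  have e2 := extModel_fromBlocks η A (Y.submatrix id i.succAbove) (W.submatrix id i.succAbove)
    (Z.submatrix i.succAbove i.succAbove) (fun a j => by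
      simp [hW, Fin.sum_univ_succAbove (fun l => Z l (i.succAbove j)) i, hZ])
  refine nonnegSSE_amalgamate hη i hV ?_ ?_ ?_
  · rw [e1]
    rintro (b | l) <;> simp [hZ]
  · rw [e1, e2]
    rintro (a | j) b
    · simp [Fin.sum_univ_succAbove (fun l => W a l) i]
      ring
    · simp [Fin.sum_univ_succAbove (fun l => W _ l) i, Fin.sum_univ_succAbove (fun l => Z _ l) i,
        Finset.sum_sub_distrib, ← Finset.mul_sum, Finset.sum_add_distrib]
      ring
  · rw [e1, e2]
    rintro (a | j) l <;> simp

end ExtensionModel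

section Shear

variable (ι : Type) [DecidableEq ι] {k : ℕ}

/-- The elementary operation adding the combination `u` of the other new basis vectors to the
`i`-th one. -/
def shear (i : Fin k) (u : Fin k → ℝ) : Matrix (ι ⊕ Fin k) (ι ⊕ Fin k) ℝ :=
  fromBlocks 1 0 0 (1 + vecMulVec (Pi.single i 1) u)

theorem shear_zero (i : Fin k) : shear ι i 0 = 1 := by
  rw [shear, vecMulVec_zero, add_zero, fromBlocks_one]

theorem continuous_shear (i : Fin k) : Continuous (shear ι i) := by
  unfold shear
  refine Continuous.matrix_fromBlocks continuous_const continuous_const continuous_const ?_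
  exact continuous_const.add (continuous_const.matrix_vecMulVec continuous_id)

variable [Fintype ι]

theorem shear_mul_shear (i : Fin k) {u : Fin k → ℝ} (hu : u i = 0) (v : Fin k → ℝ) :
    shear ι i u * shear ι i v = shear ι i (u + v) := by
  have h : vecMulVec (Pi.single i 1) u * vecMulVec (Pi.single i (1 : ℝ)) v = 0 := by
    rw [vecMulVec_mul_vecMulVec]
    simp [hu]
  simp only [shear, fromBlocks_multiply, Matrix.zero_mul, Matrix.mul_zero, add_zero, zero_add]
  congr 1
  · rw [mul_one]
  · rw [add_mul, mul_add, mul_add, h, vecMulVec_add]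
    simp only [mul_one, one_mul, add_zero]
    abel

variable {ι}

theorem shear_conj_fromBlocks (i : Fin k) (u : Fin k → ℝ) (A : Matrix ι ι ℝ)
    (Y : Matrix ι (Fin k) ℝ) (Z : Matrix (Fin k) (Fin k) ℝ) :
    shear ι i u * fromBlocks A Y 0 Z * shear ι i (-u) =
      fromBlocks A (Y * (1 + vecMulVec (Pi.single i 1) (-u))) 0
        ((1 + vecMulVec (Pi.single i 1) u) * Z * (1 + vecMulVec (Pi.single i 1) (-u))) := by
  simp [shear, fromBlocks_multiply]

theorem eventually_nonnegSSE_extModel_shear {A : Matrix ι ι ℝ} {η : ℝ}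
    (hA : ∀ c c', 0 < extModel η (fromBlocks A (0 : Matrix ι (Fin k) ℝ) 0 0) c c') (i : Fin k) :
    ∀ᶠ T in 𝓝 (fromBlocks A (0 : Matrix ι (Fin k) ℝ) 0 0),
      ∀ u ∈ Metric.closedBall (0 : Fin k → ℝ) 1, u i = 0 →
        NonnegSSE (extModel η T) (extModel η (shear ι i u * T * shear ι i (-u))) := by
  obtain ⟨U, hU, W, hW, h⟩ := exists_nhds_nonnegSSE_extModel_of_intertwine hA
  set T₀ := fromBlocks A (0 : Matrix ι (Fin k) ℝ) 0 0 with hT₀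
  have hs := continuous_shear ι i
  have hK : IsCompact (Metric.closedBall (0 : Fin k → ℝ) 1) := isCompact_closedBall _ _
  have e1 : ∀ᶠ T in 𝓝 T₀, ∀ u ∈ Metric.closedBall (0 : Fin k → ℝ) 1,
      shear ι i u * T * shear ι i (-u) ∈ U := by
    refine hK.eventually_forall_of_forall_eventually fun u _ => ?_
    have hc : Continuous fun z : Matrix (ι ⊕ Fin k) (ι ⊕ Fin k) ℝ × (Fin k → ℝ) =>
        shear ι i z.2 * z.1 * shear ι i (-z.2) := by fun_prop
    refine hc.continuousAt (x := (T₀, u)) ?_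
    dsimp only
    rw [hT₀, shear_conj_fromBlocks]
    simpa using hU
  have e2 : ∀ᶠ s in 𝓝 (0 : ℝ), ∀ u ∈ Metric.closedBall (0 : Fin k → ℝ) 1,
      shear ι i (-(s • u)) ∈ W := by
    refine hK.eventually_forall_of_forall_eventually fun u _ => ?_
    have hc : Continuous fun z : ℝ × (Fin k → ℝ) => shear ι i (-(z.1 • z.2)) := by fun_prop
    refine hc.continuousAt (x := (0, u)) ?_
    dsimp only
    rw [zero_smul, neg_zero, shear_zero]
    exact hW
  obtain ⟨M, hM⟩ := (tendsto_one_div_add_atTop_nhds_zero_nat.eventually e2).exists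
  set s : ℝ := 1 / ((M : ℝ) + 1) with hsdef
  have hM0 : (0 : ℝ) < (M : ℝ) + 1 := by positivity
  filter_upwards [e1] with T hT u hu hui
  have hball : ∀ m : ℕ, m ≤ M + 1 → (m * s) • u ∈ Metric.closedBall (0 : Fin k → ℝ) 1 := by
    intro m hm
    have hm' : (m : ℝ) ≤ M + 1 := by exact_mod_cast hm
    rw [mem_closedBall_zero_iff] at hu ⊢
    rw [norm_smul, Real.norm_of_nonneg (by positivity)]
    refine mul_le_one₀ ?_ (norm_nonneg _) hu
    rw [hsdef, mul_one_div]
    exact (div_le_one hM0).mpr hm'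
  have step : ∀ m : ℕ, m ≤ M + 1 → NonnegSSE (extModel η T)
      (extModel η (shear ι i ((m * s) • u) * T * shear ι i (-((m * s) • u)))) := by
    intro m
    induction m with
    | zero => intro _; simpa [shear_zero] using NonnegSSE.refl _
    | succ m ih =>
      intro hm
      refine (ih (by omega)).trans (h _ (hT _ (hball m (by omega))) _ (hT _ (hball _ hm)) _
        (hM u hu) ?_)
      have c1 : (((m : ℝ) * s) • u) i = 0 := by simp [hui]
      have c2 : (-((s : ℝ) • u)) i = 0 := by simp [hui]
      have f1 : -(((m + 1 : ℕ) * s : ℝ) • u) = -(((m : ℝ) * s) • u) + -(s • u) := by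
        push_cast; module
      have f2 : ((m : ℝ) * s) • u = -(s • u) + ((m + 1 : ℕ) * s : ℝ) • u := by
        push_cast; module
      rw [f1, ← shear_mul_shear ι i (by simp [hui]), ← mul_assoc, ← mul_assoc, ← mul_assoc,
        shear_mul_shear ι i c2, ← f2]
  have := step (M + 1) le_rfl
  have hone : ((M + 1 : ℕ) : ℝ) * s = 1 := by
    rw [hsdef]
    push_cast
    field_simp
  rwa [hone, one_smul] at this

end Shear

section NilpotentExtension

theorem Matrix.submatrix_succAbove_pow {k : ℕ} {N : Matrix (Fin (k + 1)) (Fin (k + 1)) ℝ}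
    {i : Fin (k + 1)} (hN : ∀ l, N i l = 0) (m : ℕ) :
    N.submatrix i.succAbove i.succAbove ^ m = (N ^ m).submatrix i.succAbove i.succAbove := by
  induction m with
  | zero => rw [pow_zero, pow_zero, submatrix_one _ Fin.succAbove_right_injective]
  | succ m ih =>
    ext a b
    rw [pow_succ, pow_succ, ih, submatrix_apply, Matrix.mul_apply, Matrix.mul_apply,
      Fin.sum_univ_succAbove _ i, hN, mul_zero, zero_add]
    rfl

theorem exists_normalized_left_null_vector {k : ℕ} {Z : Matrix (Fin (k + 1)) (Fin (k + 1)) ℝ}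
    (hZ : IsNilpotent Z) : ∃ i, ∃ u ∈ Metric.closedBall (0 : Fin (k + 1) → ℝ) 1, u i = 0 ∧
      (Pi.single i 1 + u) ᵥ* Z = 0 := by
  have hdet : Z.det = 0 := by
    obtain ⟨m, hm⟩ := hZ
    have : Z.det ^ m = 0 := by
      rw [← det_pow, hm, det_zero]
    exact eq_zero_of_pow_eq_zero this
  obtain ⟨v, hv, hvZ⟩ := Matrix.exists_vecMul_eq_zero_iff.mpr hdet
  obtain ⟨i, hi⟩ := Finite.exists_max fun j => |v j|
  have hvi : v i ≠ 0 := by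
    intro h0
    refine hv (funext fun j => ?_)
    have := hi j
    rw [h0, abs_zero] at this
    exact abs_nonpos_iff.mp this
  refine ⟨i, (v i)⁻¹ • v - Pi.single i 1, ?_, ?_, ?_⟩
  · rw [mem_closedBall_zero_iff, pi_norm_le_iff_of_nonneg zero_le_one]
    intro j
    by_cases hj : j = i
    · subst hj
      simp [hvi]
    · simp only [Pi.sub_apply, Pi.smul_apply, Pi.single_eq_of_ne hj, sub_zero, smul_eq_mul,
        Real.norm_eq_abs, abs_mul, abs_inv]
      exact inv_mul_le_one_of_le₀ (hi j) (abs_nonneg _)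
  · simp [hvi]
  · rw [add_sub_cancel, smul_vecMul, hvZ, smul_zero]

variable {ι : Type} [Fintype ι] [DecidableEq ι]

/-- Small nilpotent extensions of a positive matrix are strong shift equivalent to it. -/
theorem eventually_nonnegSSE_extModel_nilpotent [Nonempty ι] {A : Matrix ι ι ℝ}
    (hA : ∀ i j, 0 < A i j) (k : ℕ) : ∀ᶠ η in 𝓝[>] (0 : ℝ),
      ∀ᶠ p : Matrix ι ι ℝ × Matrix ι (Fin k) ℝ × Matrix (Fin k) (Fin k) ℝ in 𝓝 (A, 0, 0),
        IsNilpotent p.2.2 →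
          NonnegSSE p.1 (extModel η (fromBlocks p.1 p.2.1 0 p.2.2)) := by
  induction k with
  | zero =>
    refine Eventually.of_forall fun η => ?_
    filter_upwards [continuous_fst.continuousAt (isOpen_forall_entries_pos.mem_nhds hA)] with
      p hp _
    have hp' : ∀ i j, 0 < p.1 i j := hp
    set e := Equiv.sumEmpty ι (Fin 0)
    have h := NonnegSSE.of_mul (R := p.1.submatrix id e)
      (S := (1 : Matrix ι ι ℝ).submatrix e id) (fun i j => (hp' _ _).le) (fun i j => by
        simp only [Matrix.submatrix_apply, Matrix.one_apply]
        split_ifs <;> norm_num)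
    rw [Matrix.submatrix_mul_equiv, Matrix.mul_one, Matrix.submatrix_id_id,
      ← Matrix.submatrix_mul _ _ _ _ _ Function.bijective_id, Matrix.one_mul] at h
    convert h using 1
    rw [extModel_fromBlocks η p.1 p.2.1 0 p.2.2 (fun _ j => j.elim0)]
    ext (a | j) (b | l)
    · simp [e]
    · exact l.elim0
    · exact j.elim0
    · exact j.elim0
  | succ k ih =>
    filter_upwards [ih, eventually_extModel_pos hA (k + 1), eventually_mem_nhdsWithin] with
      η hIH hpos hη
    have hη' : 0 < η := hη
    have hK : IsCompact (Metric.closedBall (0 : Fin (k + 1) → ℝ) 1) := isCompact_closedBall _ _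
    have hblocks : Continuous fun p : Matrix ι ι ℝ × Matrix ι (Fin (k + 1)) ℝ ×
        Matrix (Fin (k + 1)) (Fin (k + 1)) ℝ => fromBlocks p.1 p.2.1 0 p.2.2 :=
      Continuous.matrix_fromBlocks continuous_fst (continuous_fst.comp continuous_snd)
        continuous_const (continuous_snd.comp continuous_snd)
    have e1 : ∀ᶠ p : Matrix ι ι ℝ × Matrix ι (Fin (k + 1)) ℝ ×
        Matrix (Fin (k + 1)) (Fin (k + 1)) ℝ in 𝓝 (A, 0, 0), ∀ i,
          ∀ u ∈ Metric.closedBall (0 : Fin (k + 1) → ℝ) 1, u i = 0 →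
            NonnegSSE (extModel η (fromBlocks p.1 p.2.1 0 p.2.2)) (extModel η
              (shear ι i u * fromBlocks p.1 p.2.1 0 p.2.2 * shear ι i (-u))) :=
      eventually_all.mpr fun i => (hblocks.tendsto (A, 0, 0)).eventually
        (eventually_nonnegSSE_extModel_shear hpos i)
    have e2 : ∀ᶠ p : Matrix ι ι ℝ × Matrix ι (Fin (k + 1)) ℝ ×
        Matrix (Fin (k + 1)) (Fin (k + 1)) ℝ in 𝓝 (A, 0, 0), ∀ i,
          ∀ u ∈ Metric.closedBall (0 : Fin (k + 1) → ℝ) 1, ∀ c c', 0 < extModel η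
            (shear ι i u * fromBlocks p.1 p.2.1 0 p.2.2 * shear ι i (-u)) c c' := by
      refine eventually_all.mpr fun i => hK.eventually_forall_of_forall_eventually fun u _ => ?_
      have hs := continuous_shear ι i
      have hc : Continuous fun z : (Matrix ι ι ℝ × Matrix ι (Fin (k + 1)) ℝ ×
          Matrix (Fin (k + 1)) (Fin (k + 1)) ℝ) × (Fin (k + 1) → ℝ) => extModel η
            (shear ι i z.2 * fromBlocks z.1.1 z.1.2.1 0 z.1.2.2 * shear ι i (-z.2)) := by
        refine (continuous_extModel η).comp ?_
        have := hblocks.comp (continuous_fst (Y := Fin (k + 1) → ℝ))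
        exact ((hs.comp continuous_snd).mul this).mul (hs.comp continuous_snd.neg)
      refine hc.continuousAt (x := ((A, 0, 0), u))
        (isOpen_forall_entries_pos.mem_nhds ?_)
      dsimp only
      rw [shear_conj_fromBlocks]
      simpa using hpos
    have e3 : ∀ᶠ p : Matrix ι ι ℝ × Matrix ι (Fin (k + 1)) ℝ ×
        Matrix (Fin (k + 1)) (Fin (k + 1)) ℝ in 𝓝 (A, 0, 0), ∀ i : Fin (k + 1),
          ∀ u ∈ Metric.closedBall (0 : Fin (k + 1) → ℝ) 1,
            IsNilpotent (((1 + vecMulVec (Pi.single i 1) u) * p.2.2 *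
              (1 + vecMulVec (Pi.single i 1) (-u))).submatrix i.succAbove i.succAbove) →
            NonnegSSE p.1 (extModel η (fromBlocks p.1
              ((p.2.1 * (1 + vecMulVec (Pi.single i 1) (-u))).submatrix id i.succAbove) 0
              (((1 + vecMulVec (Pi.single i 1) u) * p.2.2 *
                (1 + vecMulVec (Pi.single i 1) (-u))).submatrix i.succAbove i.succAbove))) := by
      refine eventually_all.mpr fun i => hK.eventually_forall_of_forall_eventually fun u _ => ?_
      have hc : Continuous fun z : (Matrix ι ι ℝ × Matrix ι (Fin (k + 1)) ℝ ×
          Matrix (Fin (k + 1)) (Fin (k + 1)) ℝ) × (Fin (k + 1) → ℝ) =>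
          (z.1.1, (z.1.2.1 * (1 + vecMulVec (Pi.single i 1) (-z.2))).submatrix id i.succAbove,
            ((1 + vecMulVec (Pi.single i 1) z.2) * z.1.2.2 *
              (1 + vecMulVec (Pi.single i 1) (-z.2))).submatrix i.succAbove i.succAbove) := by
        fun_prop
      refine (hc.continuousAt (x := ((A, 0, 0), u))).eventually (p := fun p =>
        IsNilpotent p.2.2 → NonnegSSE p.1 (extModel η (fromBlocks p.1 p.2.1 0 p.2.2))) ?_
      simpa using hIH
    filter_upwards [e1, e2, e3] with ⟨A', Y, Z⟩ h1 h2 h3 hZ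
    dsimp only at *
    obtain ⟨i, u, hu, hui, huZ⟩ := exists_normalized_left_null_vector hZ
    have hsse := h1 i u hu hui
    have hpos' := h2 i u hu
    have hrem := h3 i u hu
    rw [shear_conj_fromBlocks] at hsse hpos'
    set P : Matrix (Fin (k + 1)) (Fin (k + 1)) ℝ := 1 + vecMulVec (Pi.single i 1) u with hP
    set Q : Matrix (Fin (k + 1)) (Fin (k + 1)) ℝ := 1 + vecMulVec (Pi.single i 1) (-u) with hQ
    have hQP : Q * P = 1 := by
      have h : vecMulVec (Pi.single i 1) u * vecMulVec (Pi.single i (1 : ℝ)) u = 0 := by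
        rw [vecMulVec_mul_vecMulVec]
        simp [hui]
      rw [hQ, hP, vecMulVec_neg, add_mul, mul_add, mul_add, neg_mul, neg_mul, h]
      simp
    have hrow : ∀ l, (P * Z * Q) i l = 0 := by
      intro l
      have hPi : P i = Pi.single i 1 + u := by
        ext j
        simp [hP, Matrix.one_apply, Pi.single_apply, vecMulVec_apply, eq_comm]
      have hPZ : (P * Z) i = 0 := by
        rw [Matrix.mul_apply_eq_vecMul, hPi, huZ]
      rw [Matrix.mul_apply_eq_vecMul, hPZ, zero_vecMul]
      rfl
    have hnil : IsNilpotent ((P * Z * Q).submatrix i.succAbove i.succAbove) := by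
      obtain ⟨m, hm⟩ := hZ
      refine ⟨m, ?_⟩
      have hsc : P * Z * Q * P = P * Z := by rw [mul_assoc, hQP, mul_one]
      have hpow := SemiconjBy.mul_pow_eq hsc.symm m
      rw [hm, mul_zero] at hpow
      have h0 : (P * Z * Q) ^ m = 0 := by
        have hPQ : P * Q = 1 := mul_eq_one_comm.mp hQP
        rw [← mul_one ((P * Z * Q) ^ m), ← hPQ, ← mul_assoc, ← hpow, zero_mul]
      rw [Matrix.submatrix_succAbove_pow hrow, h0]
      rfl
    exact (hrem hnil).trans (hsse.trans
      (nonnegSSE_extModel_succAbove hη'.le i hrow fun c c' => (hpos' c c').le)).symm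

end NilpotentExtension

section BlockShift

variable {ι : Type} [Fintype ι] [DecidableEq ι]

/-- The nilpotent block shift. -/
def blockShift (ι : Type) [DecidableEq ι] (d : ℕ) :
    Matrix (Fin (d + 1) × ι) (Fin (d + 1) × ι) ℝ :=
  of fun x y => if y.1.val = x.1.val + 1 ∧ y.2 = x.2 then 1 else 0

/-- The projection to the first block. -/
def blockHead (ι : Type) [DecidableEq ι] (d : ℕ) : Matrix ι (Fin (d + 1) × ι) ℝ :=
  of fun a y => if y.1 = 0 ∧ y.2 = a then 1 else 0

/-- The column of blocks `δ⁻¹ ^ (i + 1) • (E * B ^ i)`. -/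
noncomputable def blockColumn (d : ℕ) (δ : ℝ) (E B : Matrix ι ι ℝ) :
    Matrix (Fin (d + 1) × ι) ι ℝ :=
  of fun x b => δ⁻¹ ^ (x.1.val + 1) * (E * B ^ x.1.val) x.2 b

theorem isNilpotent_blockShift (d : ℕ) : IsNilpotent (blockShift ι d) := by
  have h : ∀ m : ℕ, ∀ x y : Fin (d + 1) × ι, y.1.val < x.1.val + m →
      (blockShift ι d ^ m) x y = 0 := by
    intro m
    induction m with
    | zero =>
      intro x y hxy
      rw [pow_zero, Matrix.one_apply_ne]
      rintro rfl
      omega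
    | succ m ih =>
      intro x y hxy
      rw [pow_succ, Matrix.mul_apply]
      refine Finset.sum_eq_zero fun z _ => ?_
      by_cases hz : z.1.val < x.1.val + m
      · rw [ih x z hz, zero_mul]
      · rw [blockShift, of_apply, if_neg (by omega), mul_zero]
  refine ⟨d + 1, ?_⟩
  ext x y
  exact h _ _ _ (by omega)

theorem blockHead_mul_blockColumn (d : ℕ) {δ : ℝ} (hδ : δ ≠ 0) (E B : Matrix ι ι ℝ) :
    (δ • blockHead ι d) * blockColumn d δ E B = E := by
  ext a b
  simp [Matrix.mul_apply, blockHead, blockColumn, Fintype.sum_prod_type, ite_and, hδ,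
    Matrix.one_apply]

theorem blockShift_mul_blockColumn (d : ℕ) {δ : ℝ} (hδ : δ ≠ 0) {E B : Matrix ι ι ℝ}
    (h : E * B ^ (d + 1) = 0) :
    (δ • blockShift ι d) * blockColumn d δ E B = blockColumn d δ E B * B := by
  ext ⟨i, a⟩ b
  have hr : (blockColumn d δ E B * B) (i, a) b =
      δ⁻¹ ^ (i.val + 1) * (E * B ^ (i.val + 1)) a b := by
    rw [pow_succ B, ← mul_assoc E, Matrix.mul_apply, Matrix.mul_apply, Finset.mul_sum]
    simp [blockColumn, mul_assoc]
  rw [hr, Matrix.smul_mul, Matrix.smul_apply, Matrix.mul_apply]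
  by_cases hi : i.val + 1 < d + 1
  · rw [Finset.sum_eq_single ((⟨i.val + 1, hi⟩, a) : Fin (d + 1) × ι)]
    · simp only [blockShift, blockColumn, of_apply, and_self, if_true, one_mul, smul_eq_mul]
      rw [pow_succ δ⁻¹ (i.val + 1)]
      field_simp
    · rintro ⟨j, c⟩ - hjc
      rw [blockShift, of_apply, if_neg, zero_mul]
      rintro ⟨h1, h2⟩
      exact hjc (Prod.ext (Fin.ext h1) h2)
    · simp
  · have hid : i.val + 1 = d + 1 := by omega
    rw [hid, h, Finset.sum_eq_zero]
    · simp
    · rintro ⟨j, c⟩ -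
      rw [blockShift, of_apply, if_neg (by dsimp only; omega), zero_mul]

theorem continuous_blockColumn (d : ℕ) (δ : ℝ) (A : Matrix ι ι ℝ) :
    Continuous fun B => blockColumn d δ (B - A) B := by
  refine continuous_matrix fun x b => ?_
  simp only [blockColumn, of_apply]
  fun_prop

theorem blockColumn_zero (d : ℕ) (δ : ℝ) (B : Matrix ι ι ℝ) : blockColumn d δ 0 B = 0 := by
  ext x b
  simp [blockColumn]

end BlockShift

section LocalClaim

theorem Matrix.exists_fromBlocks_zero_pow {ι κ : Type} [Fintype ι] [DecidableEq ι] [Fintype κ]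
    [DecidableEq κ] (A : Matrix ι ι ℝ) (Y : Matrix ι κ ℝ) (Z : Matrix κ κ ℝ) (m : ℕ) :
    ∃ Y', fromBlocks A Y 0 Z ^ m = fromBlocks (A ^ m) Y' 0 (Z ^ m) := by
  induction m with
  | zero => exact ⟨0, by simp⟩
  | succ m ih =>
    obtain ⟨Y', h⟩ := ih
    refine ⟨A ^ m * Y + Y' * Z, ?_⟩
    rw [pow_succ, h, fromBlocks_multiply]
    simp [pow_succ]

theorem Matrix.isNilpotent_iff_charpoly_eq {κ : Type} [Fintype κ] [DecidableEq κ]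
    {Z : Matrix κ κ ℝ} : IsNilpotent Z ↔ Z.charpoly = Polynomial.X ^ Fintype.card κ := by
  constructor
  · intro h
    have := isNilpotent_charpoly_sub_pow_of_isNilpotent h
    rwa [isNilpotent_iff_eq_zero, sub_eq_zero] at this
  · intro h
    have := Matrix.aeval_self_charpoly Z
    rw [h, map_pow, Polynomial.aeval_X] at this
    exact ⟨_, this⟩

theorem Matrix.isNilpotent_of_fromBlocks_conj {ι κ : Type} [Fintype ι] [DecidableEq ι] [Fintype κ]
    [DecidableEq κ] {A B : Matrix ι ι ℝ} {Y Y' : Matrix ι κ ℝ} {Z Z' : Matrix κ κ ℝ}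
    {G : Matrix (ι ⊕ κ) (ι ⊕ κ) ℝ} (hG : IsUnit G)
    (h : fromBlocks A Y 0 Z * G = G * fromBlocks B Y' 0 Z') (hZ : IsNilpotent Z) {ℓ : ℕ}
    (hℓ : 1 ≤ ℓ) (hAB : (A ^ ℓ).charpoly = (B ^ ℓ).charpoly) : IsNilpotent Z' := by
  obtain ⟨G, rfl⟩ := hG
  have hpow := SemiconjBy.mul_pow_eq h.symm ℓ
  have hchar : (fromBlocks A Y 0 Z ^ ℓ).charpoly = (fromBlocks B Y' 0 Z' ^ ℓ).charpoly := by
    rw [← Units.inv_mul_cancel_left G (fromBlocks B Y' 0 Z' ^ ℓ), hpow, charpoly_mul_comm,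
      mul_assoc, Units.mul_inv, mul_one]
  obtain ⟨Y₁, h₁⟩ := Matrix.exists_fromBlocks_zero_pow A Y Z ℓ
  obtain ⟨Y₂, h₂⟩ := Matrix.exists_fromBlocks_zero_pow B Y' Z' ℓ
  rw [h₁, h₂, charpoly_fromBlocks_zero₂₁, charpoly_fromBlocks_zero₂₁, hAB] at hchar
  have hZZ := mul_left_cancel₀ (charpoly_monic (B ^ ℓ)).ne_zero hchar
  have hℓ0 : ℓ ≠ 0 := by omega
  have hZℓ : IsNilpotent (Z ^ ℓ) := (IsNilpotent.pow_iff_pos hℓ0).mpr hZ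
  rw [← IsNilpotent.pow_iff_pos hℓ0, Matrix.isNilpotent_iff_charpoly_eq, ← hZZ]
  exact Matrix.isNilpotent_iff_charpoly_eq.mp hZℓ

variable {ι : Type} [Fintype ι] [DecidableEq ι]

/-- Arbitrarily small nilpotent extensions `δ • Y₀`, `δ • Z₀` which realize the difference
`B - A`. -/
theorem exists_shift_extension (d : ℕ) : ∃ (k : ℕ) (Y₀ : Matrix ι (Fin k) ℝ)
    (Z₀ : Matrix (Fin k) (Fin k) ℝ), IsNilpotent Z₀ ∧ ∀ δ : ℝ, δ ≠ 0 → ∀ A : Matrix ι ι ℝ,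
      ∃ F : Matrix ι ι ℝ → Matrix (Fin k) ι ℝ, Continuous F ∧ F A = 0 ∧
        ∀ B, (B - A) * B ^ d = 0 →
          (δ • Y₀) * F B = B - A ∧ (δ • Z₀) * F B = F B * B := by
  set e := (Fintype.equivFin (Fin (d + 1) × ι)).symm
  refine ⟨_, (blockHead ι d).submatrix id e, (blockShift ι d).submatrix e e, ?_, ?_⟩
  · exact (isNilpotent_blockShift d).map (Matrix.reindexAlgEquiv ℝ ℝ e.symm)
  · intro δ hδ A
    refine ⟨fun B => (blockColumn d δ (B - A) B).submatrix e id,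
      (continuous_blockColumn d δ A).matrix_submatrix _ _, ?_, fun B hB => ⟨?_, ?_⟩⟩
    · dsimp only
      rw [sub_self, blockColumn_zero, submatrix_zero]
      rfl
    · change (δ • blockHead ι d).submatrix id e *
        (blockColumn d δ (B - A) B).submatrix e id = B - A
      rw [submatrix_mul_equiv, blockHead_mul_blockColumn d hδ, submatrix_id_id]
    · have hB' : (B - A) * B ^ (d + 1) = 0 := by rw [pow_succ, ← mul_assoc, hB, zero_mul]
      change (δ • blockShift ι d).submatrix e e * (blockColumn d δ (B - A) B).submatrix e id =
        (blockColumn d δ (B - A) B).submatrix e id * B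
      rw [submatrix_mul_equiv, blockShift_mul_blockColumn d hδ hB',
        submatrix_mul _ _ e id id Function.bijective_id, submatrix_id_id]

theorem eventually_nonnegSSE_of_mul_pow_eq_zero [Nonempty ι] {A : Matrix ι ι ℝ}
    (hA : ∀ i j, 0 < A i j) (d : ℕ) : ∀ᶠ B in 𝓝 A, (B - A) * B ^ d = 0 →
      (∃ ℓ : ℕ, (A ^ ℓ).charpoly = (B ^ ℓ).charpoly ∧ 1 ≤ ℓ) → NonnegSSE A B := by
  obtain ⟨k, Y₀, Z₀, hZ₀, hF⟩ := exists_shift_extension (ι := ι) d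
  obtain ⟨η, hpos, hnil⟩ := ((eventually_extModel_pos hA k).and
    (eventually_nonnegSSE_extModel_nilpotent hA k)).exists
  obtain ⟨U, hU, W, hW, hUW⟩ := exists_nhds_nonnegSSE_extModel_of_intertwine hpos
  have hblocks : Continuous fun p : Matrix ι ι ℝ × Matrix ι (Fin k) ℝ ×
      Matrix (Fin k) (Fin k) ℝ => fromBlocks p.1 p.2.1 0 p.2.2 :=
    Continuous.matrix_fromBlocks continuous_fst (continuous_fst.comp continuous_snd)
      continuous_const (continuous_snd.comp continuous_snd)
  have hgood := hnil.and ((hblocks.tendsto (A, 0, 0)).eventually hU)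
  obtain ⟨δ, hδ, hgoodδ⟩ : ∃ δ : ℝ, δ ≠ 0 ∧ ∀ᶠ p in 𝓝 (A, δ • Y₀, δ • Z₀),
      (IsNilpotent p.2.2 → NonnegSSE p.1 (extModel η (fromBlocks p.1 p.2.1 0 p.2.2))) ∧
        fromBlocks p.1 p.2.1 0 p.2.2 ∈ U := by
    have hc : Continuous fun δ : ℝ => (A, δ • Y₀, δ • Z₀) := by fun_prop
    have ht := hc.tendsto 0
    rw [zero_smul, zero_smul] at ht
    have h1 := (ht.eventually (eventually_eventually_nhds.mpr hgood)).filter_mono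
      (nhdsWithin_le_nhds (s := {0}ᶜ))
    have h2 : ∀ᶠ δ in 𝓝[≠] (0 : ℝ), δ ≠ 0 := eventually_mem_nhdsWithin
    exact (h2.and h1).exists
  obtain ⟨F, hFc, hFA, hFB⟩ := hF δ hδ A
  set Y := δ • Y₀
  set Z := δ • Z₀ with hZdef
  have hZ : IsNilpotent Z := by
    obtain ⟨m, hm⟩ := hZ₀
    exact ⟨m, by rw [hZdef, smul_pow, hm, smul_zero]⟩
  have e1 : Tendsto (fun B => (B, Y, Z - F B * Y)) (𝓝 A) (𝓝 (A, Y, Z)) := by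
    have hc : Continuous fun B => (B, Y, Z - F B * Y) := by fun_prop
    have := hc.tendsto A
    rwa [hFA, Matrix.zero_mul, sub_zero] at this
  have e2 : Tendsto (fun B => fromBlocks 1 0 (F B) 1) (𝓝 A)
      (𝓝 (1 : Matrix (ι ⊕ Fin k) (ι ⊕ Fin k) ℝ)) := by
    have hc : Continuous fun B => fromBlocks (1 : Matrix ι ι ℝ) 0 (F B)
        (1 : Matrix (Fin k) (Fin k) ℝ) :=
      Continuous.matrix_fromBlocks continuous_const continuous_const hFc continuous_const
    have := hc.tendsto A
    rwa [hFA, fromBlocks_one] at this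
  have hself := hgoodδ.self_of_nhds
  filter_upwards [e1.eventually hgoodδ, e2.eventually hW] with B hB hG hBd ⟨ℓ, hchar, hℓ⟩
  obtain ⟨hYF, hZF⟩ := hFB B hBd
  have hconj : fromBlocks A Y 0 Z * fromBlocks 1 0 (F B) 1 =
      fromBlocks 1 0 (F B) 1 * fromBlocks B Y 0 (Z - F B * Y) := by
    simp only [fromBlocks_multiply, hYF, hZF]
    simp
  have hunit : IsUnit (fromBlocks (1 : Matrix ι ι ℝ) 0 (F B) (1 : Matrix (Fin k) (Fin k) ℝ)) := by
    rw [Matrix.isUnit_iff_isUnit_det, det_fromBlocks_zero₁₂]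
    simp
  have hZ' := Matrix.isNilpotent_of_fromBlocks_conj hunit hconj hZ hℓ hchar
  exact (hself.1 hZ).trans ((hUW _ hself.2 _ hB.2 _ hG hconj).trans (hB.1 hZ').symm)

/-- Matrices close to a positive matrix `A` and shift equivalent to `A` over `ℝ` are strong shift
equivalent to `A` over the nonnegative reals. -/
theorem eventually_nonnegSSE_of_realSE [Nonempty ι] {A : Matrix ι ι ℝ} (hA : ∀ i j, 0 < A i j) :
    ∀ᶠ B in 𝓝 A, RealSE A B → NonnegSSE A B := by
  set d := Module.finrank ℝ (Matrix ι ι ℝ)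
  have hconj : Tendsto (fun p : Matrix ι ι ℝ × Matrix ι ι ℝ => (p.2 * p.1 * p.2⁻¹, p.1, p.2))
      (𝓝 (A, 1)) (𝓝 (A, A, 1)) := by
    have t1 : Tendsto (fun p : Matrix ι ι ℝ × Matrix ι ι ℝ => p.1) (𝓝 (A, 1)) (𝓝 A) :=
      continuous_fst.tendsto _
    have t2 : Tendsto (fun p : Matrix ι ι ℝ × Matrix ι ι ℝ => p.2) (𝓝 (A, 1)) (𝓝 1) :=
      continuous_snd.tendsto _
    have t3 := (t2.mul t1).mul (tendsto_matrix_inv (by simp) t2)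
    rw [inv_one, mul_one, one_mul] at t3
    exact t3.prodMk_nhds (t1.prodMk_nhds t2)
  have hdet : ∀ᶠ p : Matrix ι ι ℝ × Matrix ι ι ℝ in 𝓝 (A, 1), p.2.det ≠ 0 := by
    have hc : Continuous fun p : Matrix ι ι ℝ × Matrix ι ι ℝ => p.2.det :=
      continuous_snd.matrix_det
    exact (hc.tendsto (A, 1)).eventually_ne (by simp)
  have h1 := hconj.eventually (eventually_nonnegSSE_of_intertwine hA)
  have h2 := hconj.fst_nhds.eventually (eventually_nonnegSSE_of_mul_pow_eq_zero hA d)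
  have h3 := h1.and (h2.and hdet)
  rw [nhds_prod_eq, eventually_prod_iff] at h3
  obtain ⟨p, hp, q, hq, hpq⟩ := h3
  filter_upwards [hp, eventually_exists_intertwiner A (W := {L | q L}) hq] with B hB hex hse
  obtain ⟨L, hL, hLB⟩ := hex hse
  obtain ⟨g1, g2, g3⟩ := hpq hB hL
  dsimp only at g1 g2 g3
  have hu : IsUnit L.det := isUnit_iff_ne_zero.mpr g3
  have hB₁ : L * B * L⁻¹ * L = L * B := Matrix.nonsing_inv_mul_cancel_right _ _ hu
  have hpow : ∀ m, L * B ^ m = (L * B * L⁻¹) ^ m * L := SemiconjBy.mul_pow_eq hB₁.symm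
  have hpow' : ∀ m, (L * B * L⁻¹) ^ m = L * B ^ m * L⁻¹ := fun m => by
    rw [hpow, Matrix.mul_nonsing_inv_cancel_right _ _ hu]
  refine (g2 ?_ ?_).trans (g1 hB₁)
  · have hAL : A * L - L * B = (A - L * B * L⁻¹) * L := by rw [sub_mul, hB₁]
    have : (A * L - L * B) * B ^ d * L⁻¹ = (A - L * B * L⁻¹) * (L * B * L⁻¹) ^ d := by
      rw [hpow', hAL]
      simp only [mul_assoc]
    rw [← neg_sub, neg_mul, ← this, hLB, zero_mul, neg_zero]
  · obtain ⟨ℓ, hchar, hℓ⟩ := hse.exists_charpoly_pow_eq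
    refine ⟨ℓ, ?_, hℓ⟩
    rw [hchar, hpow', charpoly_mul_comm, ← mul_assoc, Matrix.nonsing_inv_mul _ hu, one_mul]

end LocalClaim

/-- Matrices on a continuous path of positive `n × n` real matrices, all shift
equivalent over `ℝ` to the initial matrix, have SSE-`ℝ₊` endpoints. -/
theorem se_path_theorem (n : ℕ) (A : ℝ → Matrix (Fin n) (Fin n) ℝ)
    (hcont : ContinuousOn A (Set.Icc 0 1))
    (hpos : ∀ t ∈ Set.Icc (0 : ℝ) 1, PosEntries (A t))
    (hse : ∀ t ∈ Set.Icc (0 : ℝ) 1, ∃ (ℓ : ℕ) (R S : Matrix (Fin n) (Fin n) ℝ),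
      1 ≤ ℓ ∧ (A t) ^ ℓ = R * S ∧ (A 0) ^ ℓ = S * R ∧
      A t * R = R * A 0 ∧ S * A t = A 0 * S) :
    SSE {x : ℝ | 0 ≤ x} ⟨n, A 0⟩ ⟨n, A 1⟩ := by
  rcases Nat.eq_zero_or_pos n with rfl | hn
  · rw [Subsingleton.elim (A 1) (A 0)]
    exact Relation.ReflTransGen.refl
  have : Nonempty (Fin n) := ⟨⟨0, hn⟩⟩
  have h0 : (0 : ℝ) ∈ Set.Icc (0 : ℝ) 1 := by simp
  have h1 : (1 : ℝ) ∈ Set.Icc (0 : ℝ) 1 := by simp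
  refine NonnegSSE.toSSE (fun i j => (hpos 0 h0 i j).le) (fun i j => (hpos 1 h1 i j).le) ?_
  refine isPreconnected_Icc.induction₂ (fun s t => NonnegSSE (A s) (A t)) (fun t₀ ht₀ => ?_)
    (fun _ _ _ _ _ _ => NonnegSSE.trans) (fun _ _ _ _ => NonnegSSE.symm) h0 h1
  filter_upwards [(hcont t₀ ht₀).eventually (eventually_nonnegSSE_of_realSE (hpos t₀ ht₀)),
    self_mem_nhdsWithin] with t ht htmem
  exact ht (RealSE.trans (hse t₀ ht₀) (RealSE.symm (hse t htmem)))
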